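/- arXiv:1708.00585 — 2 statements merged into one kernel-verified Lean document; each statement's English description precedes it below -/
import Mathlib

section
/- Let K be a convex cone in a real Hilbert space H with K \ {0} ≠ ∅, let ρ > 0, let x ∈ K^⊖, and suppose there is a nonempty subset C of K with ‖y‖ = ρ for every y ∈ C and K = pos C. Set D := K ∩ S(0,ρ) and κ := sup_{y∈C} ⟨x,y⟩. If P_C(x) ≠ ∅ and κ < 0, then P_D(x) = P_C(x). -/
open Metric Set
open scoped RealInnerProductSpace BigOperators

noncomputable section

/-- The (possibly set-valued) projector onto a subset `C`. -/
def projSet {H : Type*} [NormedAddCommGroup H] (C : Set H) (x : H) : Set H :=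
  {u | u ∈ C ∧ dist x u = Metric.infDist x C}

/-- `pos C`: all finite nonnegative linear combinations of elements of `C`. -/
def posSpan {H : Type*} [NormedAddCommGroup H] [InnerProductSpace ℝ H] (C : Set H) : Set H :=
  {x | ∃ (n : ℕ) (a : Fin n → ℝ) (v : Fin n → H),
    (∀ i, 0 ≤ a i) ∧ (∀ i, v i ∈ C) ∧ x = ∑ i, a i • v i}

/-- `cone C = ⋃_{λ > 0} λ C`, the conical hull of `C`. -/
def conicalHull {H : Type*} [NormedAddCommGroup H] [InnerProductSpace ℝ H] (C : Set H) :
    Set H :=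
  {x | ∃ c : ℝ, 0 < c ∧ ∃ y ∈ C, x = c • y}

/-- Projecting `x` onto a subset of a sphere centred at the origin amounts to maximizing `⟪x, ·⟫`. -/
theorem mem_projSet_iff_of_norm_eq {H : Type*} [NormedAddCommGroup H] [InnerProductSpace ℝ H]
    {S : Set H} {ρ : ℝ} (hS : ∀ y ∈ S, ‖y‖ = ρ) (x u : H) :
    u ∈ projSet S x ↔ u ∈ S ∧ ∀ y ∈ S, ⟪x, y⟫ ≤ (⟪x, u⟫ : ℝ) := by
  refine and_congr_right fun hu => ?_
  have key : ∀ y ∈ S, dist x u ≤ dist x y ↔ ⟪x, y⟫ ≤ (⟪x, u⟫ : ℝ) := by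
    intro y hy
    rw [dist_eq_norm, dist_eq_norm, ← sq_le_sq₀ (norm_nonneg _) (norm_nonneg _),
      norm_sub_sq_real, norm_sub_sq_real, hS y hy, hS u hu]
    constructor <;> intro h <;> linarith
  constructor
  · intro h y hy
    rw [← key y hy, h]
    exact Metric.infDist_le_dist_of_mem hy
  · intro h
    refine le_antisymm ?_ (Metric.infDist_le_dist_of_mem hu)
    exact (Metric.le_infDist ⟨u, hu⟩).2 fun y hy => (key y hy).2 (h y hy)

/-- A nonnegative combination of vectors of norm `ρ` which has norm `ρ` itself and is none of those
vectors has coefficient sum larger than one. -/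
theorem one_lt_sum_of_norm_eq {H : Type*} [NormedAddCommGroup H] [InnerProductSpace ℝ H]
    {ι : Type*} [Fintype ι] {ρ : ℝ} (hρ : 0 < ρ) {a : ι → ℝ} {v : ι → H}
    (ha : ∀ i, 0 ≤ a i) (hv : ∀ i, ‖v i‖ = ρ) (hy : ‖∑ i, a i • v i‖ = ρ)
    (hne : ∀ i, v i ≠ ∑ j, a j • v j) : 1 < ∑ i, a i := by
  set y := ∑ i, a i • v i with hydef
  have hlt : ∀ i, (⟪y, v i⟫ : ℝ) < ρ ^ 2 := by
    intro i
    have hpos : 0 < ‖y - v i‖ := norm_pos_iff.2 (sub_ne_zero.2 (hne i).symm)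
    have h := norm_sub_sq_real y (v i)
    rw [hy, hv i] at h
    nlinarith [pow_pos hpos 2]
  obtain ⟨i, hi⟩ : ∃ i, 0 < a i := by
    by_contra! h
    have h0 : y = 0 := Finset.sum_eq_zero fun i _ => by rw [le_antisymm (h i) (ha i), zero_smul]
    rw [h0, norm_zero] at hy
    exact hρ.ne hy
  have hsum : ρ ^ 2 = ∑ i, a i * (⟪y, v i⟫ : ℝ) := by
    rw [← hy, ← real_inner_self_eq_norm_sq]
    nth_rewrite 2 [hydef]
    simp only [inner_sum, real_inner_smul_right]
  have hstrict : ρ ^ 2 < (∑ i, a i) * ρ ^ 2 := by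
    conv_lhs => rw [hsum]
    rw [Finset.sum_mul]
    exact Finset.sum_lt_sum (fun j _ => mul_le_mul_of_nonneg_left (hlt j).le (ha j))
      ⟨i, Finset.mem_univ i, mul_lt_mul_of_pos_left (hlt i) hi⟩
  nlinarith [pow_pos hρ 2]

/-- If `⟪x, ·⟫` is at most `m < 0` on a subset `C` of a sphere, then it is less than `m` at the
points of the sphere that lie in `posSpan C` but not in `C`. -/
theorem inner_lt_of_mem_posSpan {H : Type*} [NormedAddCommGroup H] [InnerProductSpace ℝ H]
    {C : Set H} {ρ m : ℝ} (hρ : 0 < ρ) (hC : ∀ v ∈ C, ‖v‖ = ρ) {x y : H} (hm : m < 0)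
    (hxm : ∀ v ∈ C, ⟪x, v⟫ ≤ m) (hy : y ∈ posSpan C) (hyρ : ‖y‖ = ρ) (hyC : y ∉ C) :
    ⟪x, y⟫ < m := by
  obtain ⟨n, a, v, ha, hv, rfl⟩ := hy
  have h1 : 1 < ∑ i, a i :=
    one_lt_sum_of_norm_eq hρ ha (fun i => hC _ (hv i)) hyρ fun i h => hyC (h ▸ hv i)
  calc (⟪x, ∑ i, a i • v i⟫ : ℝ) = ∑ i, a i * ⟪x, v i⟫ := by
        simp only [inner_sum, real_inner_smul_right]
    _ ≤ ∑ i, a i * m :=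
        Finset.sum_le_sum fun i _ => mul_le_mul_of_nonneg_left (hxm _ (hv i)) (ha i)
    _ = (∑ i, a i) * m := by rw [Finset.sum_mul]
    _ < m := by nlinarith

theorem projD_eq_projC_of_sup_neg
    {H : Type*} [NormedAddCommGroup H] [InnerProductSpace ℝ H] [CompleteSpace H]
    (K : Set H) (hKconv : Convex ℝ K)
    (hKcone : ∀ ⦃c : ℝ⦄, 0 < c → ∀ ⦃y⦄, y ∈ K → c • y ∈ K)
    (hK0 : (K \ {0}).Nonempty)
    (ρ : ℝ) (hρ : 0 < ρ)
    (x : H) (hx : ∀ y ∈ K, ⟪x, y⟫ ≤ (0 : ℝ))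
    (C : Set H) (hCne : C.Nonempty) (hCK : C ⊆ K)
    (hCnorm : ∀ y ∈ C, ‖y‖ = ρ) (hKpos : K = posSpan C)
    (D : Set H) (hD : D = K ∩ Metric.sphere 0 ρ)
    (κ : ℝ) (hκ : κ = sSup ((fun y => ⟪x, y⟫) '' C))
    (hne : (projSet C x).Nonempty) (hneg : κ < 0) :
    projSet D x = projSet C x := by
  have hDnorm : ∀ y ∈ D, ‖y‖ = ρ := by
    rw [hD]
    exact fun y hy => mem_sphere_zero_iff_norm.1 hy.2
  have hCD : C ⊆ D := by
    rw [hD]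
    exact fun y hy => ⟨hCK hy, mem_sphere_zero_iff_norm.2 (hCnorm y hy)⟩
  have hCneg : ∀ y ∈ C, (⟪x, y⟫ : ℝ) < 0 := by
    intro y hy
    refine lt_of_le_of_lt ?_ hneg
    rw [hκ]
    refine le_csSup ⟨0, ?_⟩ (mem_image_of_mem _ hy)
    rintro _ ⟨z, hz, rfl⟩
    exact hx z (hCK hz)
  have hlt : ∀ u ∈ projSet C x, ∀ y ∈ D, y ∉ C → (⟪x, y⟫ : ℝ) < ⟪x, u⟫ := by
    intro u hu y hy hyC
    obtain ⟨huC, hmax⟩ := (mem_projSet_iff_of_norm_eq hCnorm x u).1 hu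
    have hyK : y ∈ posSpan C := hKpos ▸ (hD ▸ hy : y ∈ K ∩ Metric.sphere 0 ρ).1
    exact inner_lt_of_mem_posSpan hρ hCnorm (hCneg u huC) hmax hyK (hDnorm y hy) hyC
  ext u
  constructor
  · intro hu
    obtain ⟨huD, hmax⟩ := (mem_projSet_iff_of_norm_eq hDnorm x u).1 hu
    refine (mem_projSet_iff_of_norm_eq hCnorm x u).2 ⟨?_, fun y hy => hmax y (hCD hy)⟩
    by_contra huC
    obtain ⟨w, hw⟩ := hne
    exact (hlt w hw u huD huC).not_ge (hmax w (hCD hw.1))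
  · intro hu
    obtain ⟨huC, hmax⟩ := (mem_projSet_iff_of_norm_eq hCnorm x u).1 hu
    refine (mem_projSet_iff_of_norm_eq hDnorm x u).2 ⟨hCD huC, fun y hy => ?_⟩
    by_cases hyC : y ∈ C
    · exact hmax y hyC
    · exact (hlt u hu y hy hyC).le
end
end

section
/- Let C be a nonempty subset of a real Hilbert space H all of whose elements have the same norm (there is β with ‖y‖ = β for all y ∈ C), let x ∈ H, and let p ∈ C. Then p ∈ P_C(x) if and only if ⟨x, p⟩ = max_{y∈C} ⟨x, y⟩ (in particular the supremum is attained); consequently P_C(x) ≠ ∅ if and only if y ↦ ⟨x, y⟩ attains its supremum over C. -/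
open Metric Set
open scoped RealInnerProductSpace BigOperators

noncomputable section

theorem mem_projSet_iff_forall_dist_le {H : Type*} [NormedAddCommGroup H] {C : Set H} {x u : H} :
    u ∈ projSet C x ↔ u ∈ C ∧ ∀ y ∈ C, dist x u ≤ dist x y := by
  refine and_congr_right fun hu => ⟨fun h y hy => h ▸ infDist_le_dist_of_mem hy, fun h => ?_⟩
  exact le_antisymm ((le_infDist ⟨u, hu⟩).2 fun {y} hy => h y hy) (infDist_le_dist_of_mem hu)

theorem dist_le_dist_iff_inner_le_inner_of_norm_eq
    {H : Type*} [NormedAddCommGroup H] [InnerProductSpace ℝ H] {x u y : H} (h : ‖u‖ = ‖y‖) :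
    dist x u ≤ dist x y ↔ ⟪x, y⟫ ≤ ⟪x, u⟫ := by
  rw [dist_eq_norm, dist_eq_norm, ← sq_le_sq₀ (norm_nonneg _) (norm_nonneg _),
    norm_sub_sq_real, norm_sub_sq_real, h]
  constructor <;> intro h' <;> linarith

theorem mem_projSet_iff_forall_inner_le_of_norm_eq
    {H : Type*} [NormedAddCommGroup H] [InnerProductSpace ℝ H] {C : Set H} {β : ℝ}
    (hβ : ∀ y ∈ C, ‖y‖ = β) {x u : H} :
    u ∈ projSet C x ↔ u ∈ C ∧ ∀ y ∈ C, ⟪x, y⟫ ≤ ⟪x, u⟫ :=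
  mem_projSet_iff_forall_dist_le.trans <| and_congr_right fun hu => forall₂_congr fun y hy =>
    dist_le_dist_iff_inner_le_inner_of_norm_eq ((hβ u hu).trans (hβ y hy).symm)

theorem mem_proj_iff_max_inner_of_equal_norms
    {H : Type*} [NormedAddCommGroup H] [InnerProductSpace ℝ H] [CompleteSpace H]
    (C : Set H) (hCne : C.Nonempty) (β : ℝ) (hβ : ∀ y ∈ C, ‖y‖ = β)
    (x p : H) (hp : p ∈ C) :
    (p ∈ projSet C x ↔ IsGreatest ((fun y => ⟪x, y⟫) '' C) ⟪x, p⟫) ∧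
      ((projSet C x).Nonempty ↔ ∃ u ∈ C, ∀ y ∈ C, ⟪x, y⟫ ≤ ⟪x, u⟫) := by
  refine ⟨?_, exists_congr fun u => mem_projSet_iff_forall_inner_le_of_norm_eq hβ⟩
  rw [mem_projSet_iff_forall_inner_le_of_norm_eq hβ, IsGreatest, mem_upperBounds,
    forall_mem_image]
  exact and_congr_left fun _ => iff_of_true hp (mem_image_of_mem _ hp)
end
end
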